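/- Let d ≥ 2, N ≥ 1, and let P : ℝ^d → ℝ be a homogeneous polynomial of degree 2N. Then Δ^N P is a constant function, and Δ^N P = ( ∏_{j=1}^{N} 2j(2j + d − 2) ) · ⨍_{S^{d−1}} P dσ, where ⨍_{S^{d−1}} P dσ denotes the average of P over the unit sphere S^{d−1} ⊂ ℝ^d with respect to the rotation-invariant probability measure. -/

import Mathlib

noncomputable section
open MeasureTheory
open scoped ENNReal

/-- `P : ℝ^d → ℝ` is (given by) a homogeneous polynomial of degree `m`. -/
def IsHomogPoly (d m : ℕ) (P : EuclideanSpace ℝ (Fin d) → ℝ) : Prop :=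
  ∃ p : MvPolynomial (Fin d) ℝ, p.IsHomogeneous m ∧
    ∀ x, P x = MvPolynomial.eval (fun i => x i) p

/-- The Laplace operator `Δ = Σ ∂²/∂x_j²` on functions on `ℝ^d`. -/
def lap (d : ℕ) (g : EuclideanSpace ℝ (Fin d) → ℝ) (x : EuclideanSpace ℝ (Fin d)) : ℝ :=
  ∑ i, iteratedFDeriv ℝ 2 g x ![EuclideanSpace.single i 1, EuclideanSpace.single i 1]

open Metric Module
open scoped RealInnerProductSpace

namespace MvPolynomial

variable {σ R : Type*}

/-- The formal Laplacian of a polynomial. -/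
def laplacian [Fintype σ] [CommSemiring R] (p : MvPolynomial σ R) : MvPolynomial σ R :=
  ∑ i, pderiv i (pderiv i p)

/-- The generator `x_i ∂_j - x_j ∂_i` of the rotations in the plane of the `i`-th and `j`-th
coordinates. -/
def rotationGenerator [CommRing R] (i j : σ) (p : MvPolynomial σ R) : MvPolynomial σ R :=
  X i * pderiv j p - X j * pderiv i p

protected theorem IsHomogeneous.laplacian [Fintype σ] [CommSemiring R] {p : MvPolynomial σ R} {m : ℕ}
    (hp : p.IsHomogeneous m) : (laplacian p).IsHomogeneous (m - 2) := by
  refine IsHomogeneous.sum _ _ _ fun i _ => ?_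
  simpa [Nat.sub_sub] using hp.pderiv.pderiv (i := i) (n := m - 1)

theorem IsHomogeneous.laplacian_iterate [Fintype σ] [CommSemiring R] (n : ℕ)
    {p : MvPolynomial σ R} (hp : p.IsHomogeneous (2 * n)) :
    (MvPolynomial.laplacian^[n] p).IsHomogeneous 0 := by
  induction n generalizing p with
  | zero => exact hp
  | succ n ih => exact ih hp.laplacian

theorem pderiv_X_mul [CommSemiring R] [DecidableEq σ] (i j : σ) (q : MvPolynomial σ R) :
    pderiv j (X i * q) = (if i = j then q else 0) + X i * pderiv j q := by
  rw [pderiv_mul, pderiv_X, Pi.single_apply]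
  split_ifs <;> simp

/-- On homogeneous polynomials of degree `m`, the sum of the squared rotation generators is
`2 (r² Δ - m (m + d - 2))`. -/
theorem IsHomogeneous.sum_rotationGenerator_sq [Fintype σ] [CommRing R] {p : MvPolynomial σ R} {m : ℕ}
    (hp : p.IsHomogeneous m) :
    ∑ i, ∑ j, rotationGenerator i j (rotationGenerator i j p) =
      2 * ((∑ i, X i ^ 2) * laplacian p) -
        2 * ((m * (m + Fintype.card σ - 2) : MvPolynomial σ R) * p) := by
  classical
  have hE : ∑ i, X i * pderiv i p = (m : MvPolynomial σ R) * p := by simpa using hp.sum_X_mul_pderiv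
  have hS : ∑ i, ∑ j, X i * (X j * pderiv j (pderiv i p)) =
      (m : MvPolynomial σ R) * (m * p) - m * p := by
    have h : ∑ j, X j * pderiv j (∑ i, X i * pderiv i p) =
        (m : MvPolynomial σ R) * (m * p) := by
      have hE' : ∀ j, pderiv j ((m : MvPolynomial σ R) * p) = m * pderiv j p := fun j => by
        rw [← nsmul_eq_mul, map_nsmul, nsmul_eq_mul]
      simp only [hE, hE', mul_left_comm _ (m : MvPolynomial σ R), ← Finset.mul_sum]
    rw [← h, Finset.sum_comm]
    conv_rhs => enter [2]; rw [← hE]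
    rw [← Finset.sum_sub_distrib]
    refine Finset.sum_congr rfl fun j _ => ?_
    simp only [map_sum, pderiv_X_mul, Finset.sum_add_distrib, Finset.sum_ite_eq',
      Finset.mem_univ, if_true, mul_add, Finset.mul_sum]
    rw [add_sub_cancel_left]
    exact Finset.sum_congr rfl fun i _ => mul_left_comm _ _ _
  have h₁ : ∑ i, ∑ j, X i * pderiv j (X i * pderiv j p) =
      (m : MvPolynomial σ R) * p + (∑ i, X i ^ 2) * laplacian p := by
    simp only [pderiv_X_mul, mul_add, mul_ite, mul_zero, Finset.sum_add_distrib,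
      Finset.sum_ite_eq, Finset.mem_univ, if_true, hE]
    simp only [laplacian, Finset.sum_mul_sum, pow_two, mul_assoc]
  have h₂ : ∑ i, ∑ j, X i * pderiv j (X j * pderiv i p) =
      (Fintype.card σ : MvPolynomial σ R) * (m * p) + (m * (m * p) - m * p) := by
    simp only [pderiv_X_mul, if_true, mul_add, Finset.sum_add_distrib, hS]
    rw [Finset.sum_comm]
    simp only [hE, Finset.sum_const, Finset.card_univ, nsmul_eq_mul]
  have h : ∀ i j, rotationGenerator i j (rotationGenerator i j p) =
      (X i * pderiv j (X i * pderiv j p) + X j * pderiv i (X j * pderiv i p)) -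
      (X i * pderiv j (X j * pderiv i p) + X j * pderiv i (X i * pderiv j p)) := fun i j => by
    simp only [rotationGenerator, map_sub]; ring
  simp only [h, Finset.sum_sub_distrib, Finset.sum_add_distrib]
  rw [Finset.sum_comm (f := fun i j => X j * pderiv i (X j * pderiv i p)),
    Finset.sum_comm (f := fun i j => X j * pderiv i (X i * pderiv j p)), h₁, h₂]
  ring

theorem continuous_eval_euclidean (p : MvPolynomial σ ℝ) :
    Continuous fun x : EuclideanSpace ℝ σ => eval (fun i => x i) p :=
  (continuous_eval p).comp (by fun_prop)

theorem hasFDerivAt_eval [Fintype σ] (p : MvPolynomial σ ℝ) (x : EuclideanSpace ℝ σ) :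
    HasFDerivAt (fun y : EuclideanSpace ℝ σ => eval (fun i => y i) p)
      (∑ k, eval (fun i => x i) (pderiv k p) • EuclideanSpace.proj (𝕜 := ℝ) k) x := by
  classical
  induction p using MvPolynomial.induction_on with
  | C a => simpa using hasFDerivAt_const a x
  | add p q hp hq =>
    simp only [map_add]
    exact (hp.add hq).congr_fderiv (by simp [add_smul, Finset.sum_add_distrib])
  | mul_X p n hp =>
    have hn : HasFDerivAt (fun y : EuclideanSpace ℝ σ => y n)
        (EuclideanSpace.proj (𝕜 := ℝ) n) x := (EuclideanSpace.proj (𝕜 := ℝ) n).hasFDerivAt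
    have h := hp.mul hn
    simp only [map_mul, eval_X]
    refine h.congr_fderiv ?_
    ext v
    simp [pderiv_X, Pi.single_apply, add_mul, Finset.sum_add_distrib, Finset.mul_sum,
      apply_ite, mul_assoc]

end MvPolynomial

open MvPolynomial

theorem lap_eval {d : ℕ} (p : MvPolynomial (Fin d) ℝ) :
    lap d (fun x => eval (fun i => x i) p) = fun x => eval (fun i => x i) (laplacian p) := by
  have h : ∀ (q : MvPolynomial (Fin d) ℝ) (y : EuclideanSpace ℝ (Fin d)) (k : Fin d),
      fderiv ℝ (fun x : EuclideanSpace ℝ (Fin d) => eval (fun i => x i) q) y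
        (EuclideanSpace.single k 1) = eval (fun i => y i) (pderiv k q) := fun q y k => by
    simp [(hasFDerivAt_eval q y).fderiv]
  ext x
  have hd : DifferentiableAt ℝ
      (fderiv ℝ fun x : EuclideanSpace ℝ (Fin d) => eval (fun i => x i) p) x := by
    rw [funext fun y => (hasFDerivAt_eval p y).fderiv]
    exact DifferentiableAt.fun_sum fun k _ =>
      (hasFDerivAt_eval (pderiv k p) x).differentiableAt.smul_const _
  simp only [lap, laplacian, map_sum, iteratedFDeriv_two_apply]
  refine Finset.sum_congr rfl fun i _ => ?_
  rw [← h, ← funext fun y => h p y i, fderiv_clm_apply hd (differentiableAt_const _)]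
  simp

theorem lap_iterate_eval {d : ℕ} (p : MvPolynomial (Fin d) ℝ) (n : ℕ) :
    (lap d)^[n] (fun x => eval (fun i => x i) p) =
      fun x => eval (fun i => x i) (laplacian^[n] p) := by
  induction n generalizing p with
  | zero => rfl
  | succ n ih => rw [Function.iterate_succ_apply, lap_eval, ih, Function.iterate_succ_apply]

section Sphere

variable {E : Type*} [NormedAddCommGroup E] [InnerProductSpace ℝ E] [FiniteDimensional ℝ E]
  [MeasurableSpace E] [BorelSpace E]

theorem hausdorffMeasure_hemisphere_lt_top {n : ℕ} [Fact (finrank ℝ E = n + 1)] {v : E}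
    (hv : ‖v‖ = 1) : μH[n] {x ∈ sphere (0 : E) 1 | ⟪v, x⟫ ≤ 0} < ∞ := by
  have hfin : finrank ℝ (ℝ ∙ v)ᗮ = n :=
    Submodule.finrank_orthogonal_span_singleton (norm_ne_zero_iff.1 (by simp [hv]))
  have hf : ContDiff ℝ 1 (stereoInvFunAux v ∘ ((↑) : (ℝ ∙ v)ᗮ → E)) :=
    contDiff_stereoInvFunAux.comp (ℝ ∙ v)ᗮ.subtypeL.contDiff
  obtain ⟨K, hK⟩ := (hf.contDiffOn (s := closedBall 0 2)).exists_lipschitzOnWith one_ne_zero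
    (convex_closedBall _ _) (isCompact_closedBall _ _)
  have hsub : {x ∈ sphere (0 : E) 1 | ⟪v, x⟫ ≤ 0} ⊆
      (stereoInvFunAux v ∘ ((↑) : (ℝ ∙ v)ᗮ → E)) '' closedBall 0 2 := by
    rintro x ⟨hx, hvx⟩
    refine ⟨stereoToFun v x, ?_, ?_⟩
    · have h := (ℝ ∙ v)ᗮ.norm_orthogonalProjectionOnto_apply_le x
      rw [mem_sphere_zero_iff_norm.1 hx] at h
      rw [mem_closedBall_zero_iff, stereoToFun_apply, norm_smul, innerSL_apply_apply,
        Real.norm_of_nonneg (by apply div_nonneg <;> linarith)]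
      have : 2 / (1 - ⟪v, x⟫) ≤ 2 := by
        rw [div_le_iff₀] <;> linarith
      nlinarith [norm_nonneg ((ℝ ∙ v)ᗮ.orthogonalProjectionOnto x)]
    · have hne : x ≠ v := by
        rintro rfl
        rw [real_inner_self_eq_norm_sq, hv] at hvx
        norm_num at hvx
      exact congrArg Subtype.val (stereo_left_inv hv (x := ⟨x, hx⟩) hne)
  refine (measure_mono hsub).trans_lt
    ((hK.hausdorffMeasure_image_le (Nat.cast_nonneg n)).trans_lt ?_)
  refine ENNReal.mul_lt_top (by simp) ?_
  conv_lhs => rw [← hfin]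
  exact (isCompact_closedBall _ _).measure_lt_top

theorem hausdorffMeasure_sphere_lt_top {n : ℕ} [Fact (finrank ℝ E = n + 1)] :
    μH[n] (sphere (0 : E) 1) < ∞ := by
  have : Nontrivial E := Module.nontrivial_of_finrank_pos (R := ℝ)
    (by rw [Fact.out (p := finrank ℝ E = n + 1)]; omega)
  obtain ⟨v, hv⟩ := exists_norm_eq E zero_le_one
  refine (measure_mono (t := {x ∈ sphere (0 : E) 1 | ⟪v, x⟫ ≤ 0} ∪
    {x ∈ sphere (0 : E) 1 | ⟪-v, x⟫ ≤ 0}) fun x hx => ?_).trans_lt (measure_union_lt_top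
      (hausdorffMeasure_hemisphere_lt_top hv)
      (hausdorffMeasure_hemisphere_lt_top (by rwa [norm_neg])))
  rcases le_total ⟪v, x⟫ 0 with h | h
  · exact Or.inl ⟨hx, h⟩
  · exact Or.inr ⟨hx, by simpa using h⟩

theorem hausdorffMeasure_sphere_pos {n : ℕ} [Fact (finrank ℝ E = n + 1)] :
    0 < μH[n] (sphere (0 : E) 1) := by
  have : Nontrivial E := Module.nontrivial_of_finrank_pos (R := ℝ)
    (by rw [Fact.out (p := finrank ℝ E = n + 1)]; omega)
  obtain ⟨v, hv⟩ := exists_norm_eq E zero_le_one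
  have hfin : finrank ℝ (ℝ ∙ v)ᗮ = n :=
    Submodule.finrank_orthogonal_span_singleton (norm_ne_zero_iff.1 (by simp [hv]))
  refine lt_of_lt_of_le ?_ (hausdorffMeasure_orthogonalProjectionOnto_le (ℝ ∙ v)ᗮ n _
    (Nat.cast_nonneg n))
  have hsub : ball (0 : (ℝ ∙ v)ᗮ) 1 ⊆ (ℝ ∙ v)ᗮ.orthogonalProjectionOnto '' sphere (0 : E) 1 := by
    intro w hw
    rw [mem_ball_zero_iff] at hw
    have hvw : ⟪(w : E), v⟫ = 0 := Submodule.mem_orthogonal_singleton_iff_inner_left.1 w.2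
    refine ⟨w + √(1 - ‖w‖ ^ 2) • v, ?_, ?_⟩
    · rw [mem_sphere_zero_iff_norm, ← sq_eq_sq₀ (norm_nonneg _) zero_le_one, norm_add_sq_real,
        inner_smul_right, hvw, norm_smul, hv, mul_one, Real.norm_eq_abs, sq_abs, Real.sq_sqrt]
      · simp
      · nlinarith [norm_nonneg w]
    · rw [map_add, map_smul, Submodule.orthogonalProjectionOnto_mem_subspace_eq_self]
      simp
  refine lt_of_lt_of_le ?_ (measure_mono hsub)
  conv_rhs => rw [← hfin]
  exact measure_ball_pos _ _ one_pos

end Sphere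

/-- Rotation by the angle `t` in the plane of the `i`-th and `j`-th coordinates. -/
def planeRotation {d : ℕ} (i j : Fin d) (t : ℝ) (x : EuclideanSpace ℝ (Fin d)) :
    EuclideanSpace ℝ (Fin d) :=
  x + ((Real.cos t - 1) * x i - Real.sin t * x j) • EuclideanSpace.single i 1 +
    (Real.sin t * x i + (Real.cos t - 1) * x j) • EuclideanSpace.single j 1

section Rotation

variable {d : ℕ} {i j : Fin d}

theorem norm_planeRotation (hij : i ≠ j) (t : ℝ) (x : EuclideanSpace ℝ (Fin d)) :
    ‖planeRotation i j t x‖ = ‖x‖ := by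
  rw [← sq_eq_sq₀ (norm_nonneg _) (norm_nonneg _), planeRotation, norm_add_sq_real,
    norm_add_sq_real]
  simp [inner_smul_right, EuclideanSpace.inner_single_right, norm_smul, hij.symm]
  linear_combination (x i ^ 2 + x j ^ 2) * Real.sin_sq_add_cos_sq t

theorem isometry_planeRotation (hij : i ≠ j) (t : ℝ) : Isometry (planeRotation i j t) := by
  refine Isometry.of_dist_eq fun x y => ?_
  rw [dist_eq_norm, dist_eq_norm, ← norm_planeRotation hij t (x - y)]
  congr 1
  simp only [planeRotation, PiLp.sub_apply]
  module

theorem planeRotation_neg (hij : i ≠ j) (t : ℝ) (x : EuclideanSpace ℝ (Fin d)) :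
    planeRotation i j t (planeRotation i j (-t) x) = x := by
  ext k
  have h := Real.sin_sq_add_cos_sq t
  by_cases hi : k = i
  · subst hi
    simp [planeRotation, hij, hij.symm]
    linear_combination x k * h
  by_cases hj : k = j
  · subst hj
    simp [planeRotation, hij, hij.symm]
    linear_combination x k * h
  simp [planeRotation, hi, hj]

theorem hasDerivAt_planeRotation (hij : i ≠ j) (t : ℝ) (x : EuclideanSpace ℝ (Fin d)) :
    HasDerivAt (fun s => planeRotation i j s x)
      (-(planeRotation i j t x j) • EuclideanSpace.single i 1 +
        (planeRotation i j t x i) • EuclideanSpace.single j 1) t := by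
  have hc := (Real.hasDerivAt_cos t).sub_const 1
  have hs := Real.hasDerivAt_sin t
  have h := ((((hc.mul_const (x i)).sub (hs.mul_const (x j))).smul_const
    (EuclideanSpace.single i (1 : ℝ))).const_add x).add
    (((hs.mul_const (x i)).add (hc.mul_const (x j))).smul_const (EuclideanSpace.single j (1 : ℝ)))
  refine h.congr_deriv ?_
  simp [planeRotation, hij, hij.symm]
  module

theorem hasDerivAt_eval_planeRotation (hij : i ≠ j) (p : MvPolynomial (Fin d) ℝ) (t : ℝ)
    (x : EuclideanSpace ℝ (Fin d)) :
    HasDerivAt (fun s => eval (fun k => planeRotation i j s x k) p)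
      (eval (fun k => planeRotation i j t x k) (rotationGenerator i j p)) t := by
  refine ((hasFDerivAt_eval p (planeRotation i j t x)).comp_hasDerivAt t
    (hasDerivAt_planeRotation hij t x)).congr_deriv ?_
  simp [rotationGenerator, mul_add, Finset.sum_add_distrib]
  ring

theorem measurePreserving_planeRotation (hij : i ≠ j) (t s : ℝ) :
    MeasurePreserving (planeRotation i j t)
      (μH[s].restrict (sphere (0 : EuclideanSpace ℝ (Fin d)) 1))
      (μH[s].restrict (sphere (0 : EuclideanSpace ℝ (Fin d)) 1)) := by
  have hiso := isometry_planeRotation hij t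
  have hsurj : Function.Surjective (planeRotation i j t) :=
    fun x => ⟨_, planeRotation_neg hij t x⟩
  have hmp : MeasurePreserving (planeRotation i j t) μH[s] μH[s] :=
    ⟨hiso.continuous.measurable, by
      rw [hiso.map_hausdorffMeasure (Or.inr hsurj), hsurj.range_eq, Measure.restrict_univ]⟩
  have h := hmp.restrict_preimage (isClosed_sphere (x := 0) (ε := 1)).measurableSet
  have hpre : planeRotation i j t ⁻¹' sphere 0 1 = sphere 0 1 := by
    ext x; simp [norm_planeRotation hij]
  rwa [hpre] at h

end Rotation

section SphereIntegral

variable {d : ℕ} {s : ℝ}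

theorem integrableOn_sphere_eval
    (hs : μH[s] (sphere (0 : EuclideanSpace ℝ (Fin d)) 1) < ∞) (p : MvPolynomial (Fin d) ℝ) :
    IntegrableOn (fun x : EuclideanSpace ℝ (Fin d) => eval (fun i => x i) p)
      (sphere 0 1) μH[s] := by
  obtain ⟨M, hM⟩ := (isCompact_sphere (0 : EuclideanSpace ℝ (Fin d)) 1).exists_bound_of_continuousOn
    (continuous_eval_euclidean p).continuousOn
  exact Measure.integrableOn_of_bounded hs.ne
    (continuous_eval_euclidean p).aestronglyMeasurable
    ((ae_restrict_iff' isClosed_sphere.measurableSet).2 (.of_forall hM))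

theorem setIntegral_sphere_rotationGenerator
    (hs : μH[s] (sphere (0 : EuclideanSpace ℝ (Fin d)) 1) < ∞) (i j : Fin d)
    (p : MvPolynomial (Fin d) ℝ) :
    ∫ x in sphere (0 : EuclideanSpace ℝ (Fin d)) 1,
      eval (fun k => x k) (rotationGenerator i j p) ∂μH[s] = 0 := by
  rcases eq_or_ne i j with rfl | hij
  · simp [rotationGenerator]
  obtain ⟨M, hM⟩ := (isCompact_sphere (0 : EuclideanSpace ℝ (Fin d)) 1).exists_bound_of_continuousOn
    (continuous_eval_euclidean (rotationGenerator i j p)).continuousOn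
  have hcont : ∀ (q : MvPolynomial (Fin d) ℝ) (t : ℝ), Continuous
      fun x : EuclideanSpace ℝ (Fin d) => eval (fun k => planeRotation i j t x k) q := fun q t =>
    (continuous_eval_euclidean q).comp (isometry_planeRotation hij t).continuous
  have hzero : ∀ x : EuclideanSpace ℝ (Fin d), planeRotation i j 0 x = x := fun x => by
    simp [planeRotation]
  have hfin : IsFiniteMeasure (μH[s].restrict (sphere (0 : EuclideanSpace ℝ (Fin d)) 1)) :=
    isFiniteMeasure_restrict.2 hs.ne
  have hderiv := (hasDerivAt_integral_of_dominated_loc_of_deriv_le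
    (μ := μH[s].restrict (sphere (0 : EuclideanSpace ℝ (Fin d)) 1)) (x₀ := (0 : ℝ))
    (F := fun t x => eval (fun k => planeRotation i j t x k) p)
    (F' := fun t x => eval (fun k => planeRotation i j t x k) (rotationGenerator i j p))
    (bound := fun _ => M) Filter.univ_mem
    (.of_forall fun t => (hcont p t).aestronglyMeasurable)
    (by simpa only [hzero, IntegrableOn] using integrableOn_sphere_eval hs p)
    (hcont _ 0).aestronglyMeasurable
    ((ae_restrict_iff' isClosed_sphere.measurableSet).2 (.of_forall fun x hx t _ =>
      hM _ (by simpa [norm_planeRotation hij] using hx)))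
    (integrable_const M)
    (.of_forall fun x t _ => hasDerivAt_eval_planeRotation hij p t x)).2
  have hconst : ∀ t, ∫ x in sphere (0 : EuclideanSpace ℝ (Fin d)) 1,
      eval (fun k => planeRotation i j t x k) p ∂μH[s] =
      ∫ x in sphere (0 : EuclideanSpace ℝ (Fin d)) 1, eval (fun k => x k) p ∂μH[s] := fun t =>
    (measurePreserving_planeRotation hij t s).integral_comp
      ((isometry_planeRotation hij t).isClosedEmbedding.measurableEmbedding)
      fun x : EuclideanSpace ℝ (Fin d) => eval (fun k => x k) p
  simp only [hconst, hzero] at hderiv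
  exact hderiv.unique (hasDerivAt_const _ _)

theorem setIntegral_sphere_laplacian
    (hs : μH[s] (sphere (0 : EuclideanSpace ℝ (Fin d)) 1) < ∞) {p : MvPolynomial (Fin d) ℝ} {m : ℕ}
    (hp : p.IsHomogeneous m) :
    ∫ x in sphere (0 : EuclideanSpace ℝ (Fin d)) 1, eval (fun k => x k) (laplacian p) ∂μH[s] =
      m * (m + d - 2) *
        ∫ x in sphere (0 : EuclideanSpace ℝ (Fin d)) 1, eval (fun k => x k) p ∂μH[s] := by
  have h : ∫ x in sphere (0 : EuclideanSpace ℝ (Fin d)) 1, eval (fun k => x k)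
      (∑ i, ∑ j, rotationGenerator i j (rotationGenerator i j p)) ∂μH[s] = 0 := by
    simp only [map_sum]
    rw [integral_finsetSum _ fun i _ => integrable_finsetSum _ fun j _ =>
      integrableOn_sphere_eval hs _]
    refine Finset.sum_eq_zero fun i _ => ?_
    rw [integral_finsetSum _ fun j _ => integrableOn_sphere_eval hs _]
    exact Finset.sum_eq_zero fun j _ => setIntegral_sphere_rotationGenerator hs i j _
  rw [hp.sum_rotationGenerator_sq, setIntegral_congr_fun isClosed_sphere.measurableSet
    (g := fun x => 2 * eval (fun k => x k) (laplacian p) -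
      2 * (m * (m + d - 2)) * eval (fun k => x k) p), integral_sub, integral_const_mul,
    integral_const_mul] at h
  · linarith
  · exact (integrableOn_sphere_eval hs _).const_mul _
  · exact (integrableOn_sphere_eval hs _).const_mul _
  · intro x hx
    have hx' : ∑ i, x i ^ 2 = 1 := by
      rw [← EuclideanSpace.real_norm_sq_eq, mem_sphere_zero_iff_norm.1 hx, one_pow]
    simp [hx']
    ring

theorem setIntegral_sphere_laplacian_iterate
    (hs : μH[s] (sphere (0 : EuclideanSpace ℝ (Fin d)) 1) < ∞) (n : ℕ)
    {p : MvPolynomial (Fin d) ℝ} (hp : p.IsHomogeneous (2 * n)) :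
    ∫ x in sphere (0 : EuclideanSpace ℝ (Fin d)) 1,
        eval (fun k => x k) (laplacian^[n] p) ∂μH[s] =
      (∏ j ∈ Finset.Icc 1 n, (2 * (j : ℝ)) * (2 * (j : ℝ) + (d : ℝ) - 2)) *
        ∫ x in sphere (0 : EuclideanSpace ℝ (Fin d)) 1, eval (fun k => x k) p ∂μH[s] := by
  induction n generalizing p with
  | zero => simp
  | succ n ih =>
    rw [Function.iterate_succ_apply, ih hp.laplacian, setIntegral_sphere_laplacian hs hp,
      Finset.prod_Icc_succ_top (by omega)]
    push_cast
    ring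

end SphereIntegral

/-- For a homogeneous polynomial `P` of degree `2N` on `ℝ^d` (`d ≥ 2`),
`Δ^N P` is a constant, equal to `(∏_{j=1}^N 2j(2j+d-2))` times the average of `P` over the
unit sphere with respect to the rotation-invariant probability measure (the normalized
`(d-1)`-dimensional Hausdorff measure). -/
theorem statement15 (d : ℕ) (hd : 2 ≤ d) (N : ℕ) (hN : 1 ≤ N)
    (P : EuclideanSpace ℝ (Fin d) → ℝ) (hP : IsHomogPoly d (2 * N) P) :
    (∀ x, (lap d)^[N] P x = (lap d)^[N] P 0) ∧
      (lap d)^[N] P 0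
        = (∏ j ∈ Finset.Icc 1 N, (2 * (j : ℝ)) * (2 * (j : ℝ) + (d : ℝ) - 2)) *
            ⨍ θ in Metric.sphere (0 : EuclideanSpace ℝ (Fin d)) 1, P θ ∂μH[(d - 1 : ℝ)] := by
  obtain ⟨p, hp, hPp⟩ := hP
  obtain rfl : P = fun x => eval (fun i => x i) p := funext hPp
  obtain ⟨c, hc⟩ : ∃ c, laplacian^[N] p = C c :=
    ⟨_, totalDegree_eq_zero_iff_eq_C.1 (Nat.le_zero.1 (hp.laplacian_iterate N).totalDegree_le)⟩
  have hdim : (d : ℝ) - 1 = (d - 1 : ℕ) := by rw [Nat.cast_sub (by omega), Nat.cast_one]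
  have : Fact (finrank ℝ (EuclideanSpace ℝ (Fin d)) = (d - 1) + 1) :=
    ⟨by rw [finrank_euclideanSpace_fin]; omega⟩
  have hfin := hausdorffMeasure_sphere_lt_top (E := EuclideanSpace ℝ (Fin d)) (n := d - 1)
  have hpos := hausdorffMeasure_sphere_pos (E := EuclideanSpace ℝ (Fin d)) (n := d - 1)
  have hmain := setIntegral_sphere_laplacian_iterate hfin N hp
  have hne : μH[(d - 1 : ℕ)].real (sphere (0 : EuclideanSpace ℝ (Fin d)) 1) ≠ 0 :=
    (ENNReal.toReal_pos hpos.ne' hfin.ne).ne'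
  rw [lap_iterate_eval, hc, hdim]
  simp only [hc, eval_C, setIntegral_const, smul_eq_mul] at hmain ⊢
  refine ⟨fun _ => trivial, ?_⟩
  rw [setAverage_eq, smul_eq_mul, mul_left_comm, ← hmain, inv_mul_cancel_left₀ hne]
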